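/- There is no Barker sequence of odd length $n>13$: i.e., no $a_1,\ldots,a_n\in\{-1,1\}$ with $n$ odd, $n>13$, such that $|\sum_{j=1}^{n-k}a_ja_{j+k}|\le 1$ for all $k=1,\ldots,n-1$. -/

import Mathlib

open Finset

/-- The aperiodic autocorrelation of `b` at shift `k`, with `N` terms. -/
def autocorr (b : ℕ → ℤ) (N k : ℕ) : ℤ := ∑ i ∈ range N, b i * b (i + k)

theorem autocorr_modEq_four {b : ℕ → ℤ} (hb : ∀ i, b i = 1 ∨ b i = -1) (N k : ℕ) :
    autocorr b N k ≡
      ∑ i ∈ range N, b i + ∑ i ∈ range (N + k), b i - ∑ i ∈ range k, b i - N [ZMOD 4] := by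
  induction N with
  | zero => simp [autocorr, Int.ModEq]
  | succ N ih =>
    have hs : autocorr b (N + 1) k = autocorr b N k + b N * b (N + k) := by
      simp [autocorr, sum_range_succ]
    rw [hs, show N + 1 + k = N + k + 1 by ring, sum_range_succ, sum_range_succ _ (N + k)]
    unfold Int.ModEq at *
    rcases hb N with h | h <;> rcases hb (N + k) with h' | h' <;> rw [h, h'] <;> push_cast <;> omega

theorem sum_sign_modEq_two {b : ℕ → ℤ} (hb : ∀ i, b i = 1 ∨ b i = -1) (N : ℕ) :
    ∑ i ∈ range N, b i ≡ N [ZMOD 2] := by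
  induction N with
  | zero => simp [Int.ModEq]
  | succ N ih =>
    rw [sum_range_succ]
    unfold Int.ModEq at *
    rcases hb N with h | h <;> rw [h] <;> push_cast <;> omega

/-- The autocorrelations of a Barker sequence of odd length vanish at odd shifts and are
constant at even shifts. -/
theorem exists_autocorr_eq {b : ℕ → ℤ} {n : ℕ} (hb : ∀ i, b i = 1 ∨ b i = -1) (hn : Odd n)
    (hc : ∀ N k, 1 ≤ N → 1 ≤ k → N + k = n → |autocorr b N k| ≤ 1) :
    ∃ ε : ℤ, (ε = 1 ∨ ε = -1) ∧ ∀ N k, 1 ≤ k → N + k = n →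
      autocorr b N k = if Even k then ε else 0 := by
  refine ⟨if n % 4 = 1 then 1 else -1, by split_ifs <;> simp, ?_⟩
  intro N k hk hNk
  rcases Nat.eq_zero_or_pos N with rfl | hN
  · have : ¬ Even k := by rw [← Nat.not_even_iff_odd] at hn; simpa [← hNk] using hn
    simp [this, autocorr]
  have h1 := autocorr_modEq_four hb N k
  have h2 := autocorr_modEq_four hb k N
  have h3 := sum_sign_modEq_two hb N
  have h4 := sum_sign_modEq_two hb k
  have h5 := sum_sign_modEq_two hb n
  have h6 := abs_le.1 (hc N k hN hk hNk)
  have h7 := abs_le.1 (hc k N hk hN (by omega))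
  rw [hNk] at h1
  rw [add_comm k N, hNk] at h2
  unfold Int.ModEq at *
  rw [Nat.odd_iff] at hn
  have hpar : autocorr b N k % 2 = (N : ℤ) % 2 := by omega
  have hpar' : autocorr b k N % 2 = (k : ℤ) % 2 := by omega
  have hsum : (autocorr b N k + autocorr b k N) % 4 = (n : ℤ) % 4 := by
    have h8 : (autocorr b N k + autocorr b k N - (2 * ∑ i ∈ range n, b i - n)) % 4 = 0 := by omega
    omega
  clear h1 h2 h3 h4 h5
  simp only [Nat.even_iff]
  split_ifs <;> omega

theorem mul_reflect_eq {b : ℕ → ℤ} {n : ℕ} {ε : ℤ} (hb : ∀ i, b i = 1 ∨ b i = -1) (hn : Odd n)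
    (hn1 : 1 < n) (hε : ε = 1 ∨ ε = -1)
    (hc : ∀ N k, 1 ≤ k → N + k = n → autocorr b N k = if Even k then ε else 0)
    {i j : ℕ} (hij : i + j + 1 = n) : b i * b j = ε * (-1) ^ i := by
  have key : ∀ i j, 1 ≤ i → i + j + 1 = n → b i * b j = ε * (-1) ^ i := by
    intro i j hi hij
    have h1 := autocorr_modEq_four hb (j + 1) i
    have h2 := autocorr_modEq_four hb j (i + 1)
    rw [hc (j + 1) i hi (by omega), show j + 1 + i = n by omega, sum_range_succ] at h1
    rw [hc j (i + 1) (by omega) (by omega), show j + (i + 1) = n by omega,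
      sum_range_succ _ i] at h2
    unfold Int.ModEq at *
    rcases Nat.even_or_odd i with he | ho
    · rw [if_pos he] at h1
      rw [if_neg (by simpa [Nat.even_add_one] using he)] at h2
      rw [he.neg_one_pow]
      rcases hε with rfl | rfl <;> rcases hb i with h | h <;> rcases hb j with h' | h' <;>
        rw [h, h'] <;> push_cast at h1 h2 <;> omega
    · rw [if_neg (by simpa using ho)] at h1
      rw [if_pos ho.add_one] at h2
      rw [ho.neg_one_pow]
      rcases hε with rfl | rfl <;> rcases hb i with h | h <;> rcases hb j with h' | h' <;>
        rw [h, h'] <;> push_cast at h1 h2 <;> omega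
  rcases Nat.eq_zero_or_pos i with rfl | hi
  · have hj : Even j := by
      rw [Nat.odd_iff] at hn
      rw [Nat.even_iff]; omega
    have := key j 0 (by omega) (by omega)
    rw [hj.neg_one_pow] at this
    rw [mul_comm, this, pow_zero]
  · exact key i j hi hij

theorem alternating_sum_eq_one {b : ℕ → ℤ} {n : ℕ} {ε : ℤ} (hn : Odd n)
    (hε : ε = 1 ∨ ε = -1)
    (hc : ∀ N k, 1 ≤ k → N + k = n → autocorr b N k = if Even k then ε else 0)
    (hr : ∀ i j, i + j + 1 = n → b i * b j = ε * (-1) ^ i)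
    (hb : ∀ i, b i = 1 ∨ b i = -1)
    {k : ℕ} (hk : 2 * k + 3 ≤ n) :
    ∑ p ∈ antidiagonal (2 * k), (-1) ^ p.2 * (b p.1 * b p.2) = 1 := by
  rw [Nat.sum_antidiagonal_eq_sum_range_succ_mk]
  obtain ⟨l, hl⟩ : ∃ l, 2 * k + 1 + l = n := ⟨n - (2 * k + 1), by omega⟩
  have hle : Even l := by rw [Nat.odd_iff] at hn; rw [Nat.even_iff]; omega
  have h := hc (2 * k + 1) l (by omega) hl
  rw [if_pos hle] at h
  have hε2 : ε * ε = 1 := by rcases hε with rfl | rfl <;> norm_num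
  refine Eq.trans ?_ ((congrArg (ε * ·) h).trans hε2)
  simp only [autocorr, mul_sum]
  refine sum_congr rfl fun i hi => ?_
  rw [mem_range] at hi
  have h1 := hr (2 * k - i) (i + l) (by omega)
  have h2 : b (i + l) * b (i + l) = 1 := by rcases hb (i + l) with h | h <;> rw [h] <;> norm_num
  have h3 : ((-1 : ℤ) ^ (2 * k - i)) * (-1) ^ (2 * k - i) = 1 := by
    rw [← mul_pow]; norm_num
  generalize (-1 : ℤ) ^ (2 * k - i) = s at *
  linear_combination (-(s * b i * b (2 * k - i))) * h2 + s * b i * b (i + l) * h1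
    + ε * b i * b (i + l) * h3

/-- If `A` is the generating function of `b` and `(1 - X) A(X) = 1 + 2 F(X)`, then the even part
of `(1 - X) A(X) (1 + X) A(-X) = 1` gives a recursion for the even coefficients of `F`. -/
theorem half_diff_even {b f : ℕ → ℤ} (hb0 : b 0 = 1) (hf0 : f 0 = 0)
    (hf : ∀ i, b (i + 1) - b i = 2 * f (i + 1)) {K : ℕ}
    (hT : ∀ k ≤ K, ∑ p ∈ antidiagonal (2 * k), (-1) ^ p.2 * (b p.1 * b p.2) = 1)
    {k : ℕ} (hk : k + 1 ≤ K) :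
    f (2 * (k + 1)) =
      -∑ p ∈ antidiagonal (2 * (k + 1)), (-1) ^ p.2 * (f p.1 * f p.2) := by
  have hD : (1 - PowerSeries.X) * PowerSeries.mk b = 1 + 2 * PowerSeries.mk f := by
    ext i
    rw [sub_mul, one_mul, show (2 : PowerSeries ℤ) = PowerSeries.C 2 by simp]
    rcases i with _ | i
    · simp [hb0, hf0]
    · rw [map_sub, map_add, PowerSeries.coeff_C_mul, PowerSeries.coeff_succ_X_mul]
      simp [PowerSeries.coeff_one, hf]
  have hD' := congrArg (PowerSeries.rescale (-1 : ℤ)) hD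
  have hprod : ∀ (g : ℕ → ℤ) (m : ℕ),
      PowerSeries.coeff m (PowerSeries.mk g * PowerSeries.rescale (-1) (PowerSeries.mk g)) =
        ∑ p ∈ antidiagonal m, (-1) ^ p.2 * (g p.1 * g p.2) := by
    intro g m
    rw [PowerSeries.coeff_mul]
    refine sum_congr rfl fun p _ => ?_
    rw [PowerSeries.coeff_rescale, PowerSeries.coeff_mk, PowerSeries.coeff_mk]
    ring
  rw [← hprod]
  simp only [map_mul, map_sub, map_add, map_one, map_ofNat, PowerSeries.rescale_X] at hD'
  have hX : PowerSeries.C (-1 : ℤ) = -1 := by simp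
  rw [hX] at hD'
  set A := PowerSeries.mk b
  set F := PowerSeries.mk f with hF
  have h : A * PowerSeries.rescale (-1) A
      - PowerSeries.X ^ 2 * (A * PowerSeries.rescale (-1) A) =
      1 + PowerSeries.C 2 * (F + PowerSeries.rescale (-1) F)
        + PowerSeries.C 4 * (F * PowerSeries.rescale (-1) F) := by
    rw [show (PowerSeries.C (2 : ℤ)) = 2 by simp, show (PowerSeries.C (4 : ℤ)) = 4 by simp]
    linear_combination ((1 + PowerSeries.X) * PowerSeries.rescale (-1) A) * hD
      + (1 + 2 * F) * hD'
  have h1 := congrArg (PowerSeries.coeff (2 * (k + 1))) h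
  rw [map_sub, map_add, map_add, PowerSeries.coeff_C_mul, PowerSeries.coeff_C_mul, map_add,
    hprod b, hT _ hk, show 2 * (k + 1) = 2 * k + 2 by ring, PowerSeries.coeff_X_pow_mul,
    hprod b, hT k (by omega), PowerSeries.coeff_rescale, PowerSeries.coeff_one,
    if_neg (by omega), show 2 * k + 2 = 2 * (k + 1) by ring, pow_mul] at h1
  simp only [hF, PowerSeries.coeff_mk] at h1 ⊢
  norm_num at h1
  linarith

theorem sum_antidiagonal_modEq_two (f : ℕ → ℤ) (k : ℕ) :
    ∑ p ∈ antidiagonal (2 * k), (-1) ^ p.2 * (f p.1 * f p.2) ≡ f k [ZMOD 2] := by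
  refine (ZMod.intCast_eq_intCast_iff _ _ 2).1 ?_
  push_cast
  have hmem : (k, k) ∈ antidiagonal (2 * k) := by simp [two_mul]
  have hneg : (-1 : ZMod 2) = 1 := by decide
  have hsq : ∀ x : ZMod 2, x * x = x := by decide
  have hadd : ∀ x : ZMod 2, x + x = 0 := by decide
  simp only [hneg, one_pow, one_mul]
  rw [← add_sum_erase _ _ hmem, hsq, add_eq_left]
  refine sum_involution (fun p _ => p.swap) ?_ ?_ ?_ ?_
  · intro p _
    rw [Prod.fst_swap, Prod.snd_swap, mul_comm (f p.2 : ZMod 2), hadd]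
  · rintro ⟨i, j⟩ hp _ h
    simp only [mem_erase, HasAntidiagonal.mem_antidiagonal, ne_eq, Prod.mk.injEq, Prod.swap_prod_mk] at hp h
    omega
  · rintro ⟨i, j⟩ hp
    simp only [mem_erase, HasAntidiagonal.mem_antidiagonal, ne_eq, Prod.mk.injEq, Prod.swap_prod_mk] at hp ⊢
    omega
  · intro p _
    exact p.swap_swap

/-- The half-increments are supported on the multiples of the first run length `p`. -/
theorem half_diff_eq_zero {f : ℕ → ℤ} {M p : ℕ} (hf : ∀ i, f i = 0 ∨ f i = 1 ∨ f i = -1)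
    (hrec : ∀ k, 1 ≤ k → 2 * k ≤ M →
      f (2 * k) = -∑ q ∈ antidiagonal (2 * k), (-1) ^ q.2 * (f q.1 * f q.2))
    (hp : Odd p) (hfp : f p ≠ 0) (hlt : ∀ i < p, f i = 0) (m : ℕ) (hm : ¬ p ∣ m)
    (hmM : (Even m ∧ m ≤ M) ∨ (Odd m ∧ m + p ≤ M)) : f m = 0 := by
  have hdouble : ∀ k, 1 ≤ k → 2 * k ≤ M → f k = 0 → f (2 * k) = 0 := by
    intro k hk hkM h0
    have h1 := hrec k hk hkM
    have h2 := sum_antidiagonal_modEq_two f k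
    rw [h0] at h2
    unfold Int.ModEq at h2
    rcases hf (2 * k) with h | h | h <;> omega
  induction m using Nat.strong_induction_on with
  | _ m ih =>
  have hp2 := Nat.odd_iff.1 hp
  rcases Nat.lt_or_ge m p with hmp | hmp
  · exact hlt m hmp
  have hmp' : p < m := lt_of_le_of_ne hmp (by rintro rfl; exact hm dvd_rfl)
  have hhalf : ∀ k, k < m → 2 * k ≤ M → ¬ p ∣ k → f k = 0 := by
    intro k hkm hkM hpk
    rcases Nat.lt_or_ge k p with hkp | hkp
    · exact hlt k hkp
    refine ih k hkm hpk ?_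
    rcases Nat.even_or_odd k with he | ho
    · exact Or.inl ⟨he, by omega⟩
    · exact Or.inr ⟨ho, by omega⟩
  rcases hmM with ⟨⟨k, hk⟩, hmM⟩ | ⟨hmo, hmM⟩
  · obtain rfl : m = 2 * k := by omega
    exact hdouble k (by omega) hmM
      (hhalf k (by omega) hmM fun h => hm (h.mul_left 2))
  · have hm2 := Nat.odd_iff.1 hmo
    obtain ⟨k, hk⟩ : ∃ k, m + p = 2 * k := ⟨(m + p) / 2, by omega⟩
    have hp2k : ¬ p ∣ 2 * k := by rwa [← hk, Nat.dvd_add_left dvd_rfl]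
    have hfk : f k = 0 :=
      hhalf k (by omega) (by omega) fun h => hp2k (h.mul_left 2)
    have h0 := hdouble k (by omega) (by omega) hfk
    have hsum := hrec k (by omega) (by omega)
    have hvanish : ∀ i j, i + j = 2 * k → ¬ p ∣ i → i ≠ m → f i * f j = 0 := by
      intro i j hij hpi him
      rcases Nat.lt_or_ge i m with h | h
      · rw [ih i h hpi, zero_mul]
        rcases Nat.even_or_odd i with he | ho
        · exact Or.inl ⟨he, by omega⟩
        · exact Or.inr ⟨ho, by omega⟩
      · rw [hlt j (by omega), mul_zero]
    have hmem : ((p, m) : ℕ × ℕ) ∈ antidiagonal (2 * k) := by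
      rw [HasAntidiagonal.mem_antidiagonal]; omega
    have hmem' : ((m, p) : ℕ × ℕ) ∈ (antidiagonal (2 * k)).erase (p, m) := by
      simp only [mem_erase, HasAntidiagonal.mem_antidiagonal, ne_eq, Prod.mk.injEq]; omega
    rw [h0, ← add_sum_erase _ _ hmem, ← add_sum_erase _ _ hmem', sum_eq_zero, hmo.neg_one_pow,
      hp.neg_one_pow] at hsum
    · have : f p * f m = 0 := by linarith
      exact (mul_eq_zero.1 this).resolve_left hfp
    · rintro ⟨i, j⟩ hq
      simp only [mem_erase, HasAntidiagonal.mem_antidiagonal, ne_eq, Prod.mk.injEq] at hq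
      obtain ⟨h1, h2, h3⟩ := hq
      dsimp only
      by_cases hpi : p ∣ i
      · have hpj : ¬ p ∣ j := fun h => hp2k (h3 ▸ dvd_add hpi h)
        rw [mul_comm (f i), hvanish j i (by omega) hpj (by omega), mul_zero]
      · rw [hvanish i j h3 hpi (by omega), mul_zero]

/-- No Barker sequence of odd length greater than `13` starts with `1, 1`. -/
theorem no_normalized_barker {b : ℕ → ℤ} {n : ℕ} (hn : Odd n) (h13 : 13 < n)
    (hb : ∀ i, b i = 1 ∨ b i = -1) (hb0 : b 0 = 1) (hb1 : b 1 = 1)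
    (hc : ∀ N k, 1 ≤ N → 1 ≤ k → N + k = n → |autocorr b N k| ≤ 1) : False := by
  obtain ⟨ε, hε, hcε⟩ := exists_autocorr_eq hb hn hc
  have hr : ∀ i j, i + j + 1 = n → b i * b j = ε * (-1) ^ i := fun i j h =>
    mul_reflect_eq hb hn (by omega) hε hcε h
  have hn2 := Nat.odd_iff.1 hn
  obtain ⟨f, hf0, hfd, hf⟩ : ∃ f : ℕ → ℤ, f 0 = 0 ∧
      (∀ i, b (i + 1) - b i = 2 * f (i + 1)) ∧ ∀ i, f i = 0 ∨ f i = 1 ∨ f i = -1 := by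
    refine ⟨fun i => (b i - b (i - 1)) / 2, by simp, fun i => ?_, fun i => ?_⟩
    · simp only [Nat.add_sub_cancel]
      rcases hb i with h | h <;> rcases hb (i + 1) with h' | h' <;> rw [h, h'] <;> norm_num
    · dsimp only
      rcases hb i with h | h <;> rcases hb (i - 1) with h' | h' <;> rw [h, h'] <;> norm_num
  have hrec : ∀ k, 1 ≤ k → 2 * k ≤ n - 3 →
      f (2 * k) = -∑ q ∈ antidiagonal (2 * k), (-1) ^ q.2 * (f q.1 * f q.2) := by
    intro k hk hkn
    obtain ⟨k, rfl⟩ : ∃ l, k = l + 1 := ⟨k - 1, by omega⟩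
    exact half_diff_even hb0 hf0 hfd (K := k + 1)
      (fun l hl => alternating_sum_eq_one hn hε hcε hr hb (by omega)) le_rfl
  have hrefl : ∀ i j, 1 ≤ i → 1 ≤ j → i + j = n → f i = 0 → f j ≠ 0 := by
    intro i j hi hj hij h0 h0'
    obtain ⟨i, rfl⟩ : ∃ l, i = l + 1 := ⟨i - 1, by omega⟩
    obtain ⟨j, rfl⟩ : ∃ l, j = l + 1 := ⟨j - 1, by omega⟩
    have h1 := hfd i
    have h2 := hfd j
    have h3 := hr (i + 1) j (by omega)
    have h4 := hr i (j + 1) (by omega)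
    rw [show b (i + 1) = b i by linarith, pow_succ] at h3
    rw [show b (j + 1) = b j by linarith, h3] at h4
    have h5 : ε * (-1) ^ i ≠ 0 :=
      mul_ne_zero (by rcases hε with rfl | rfl <;> norm_num) (pow_ne_zero _ (by norm_num))
    apply h5
    linarith
  have hex : ∃ i, f i ≠ 0 := by
    by_contra! h
    exact hrefl 2 (n - 2) (by omega) (by omega) (by omega) (h _) (h _)
  obtain ⟨p, hfp, hlt⟩ : ∃ p, f p ≠ 0 ∧ ∀ i < p, f i = 0 :=
    ⟨Nat.find hex, Nat.find_spec hex, fun i hi => not_not.1 (Nat.find_min hex hi)⟩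
  have hf1 : f 1 = 0 := by
    have := hfd 0
    rw [hb0, hb1] at this
    linarith
  have hp0 : p ≠ 0 := by rintro rfl; exact hfp hf0
  have hp1 : p ≠ 1 := by rintro rfl; exact hfp hf1
  have hpn : p ≤ n - 2 := by
    by_contra! h
    exact hrefl 2 (n - 2) (by omega) (by omega) (by omega) (hlt _ (by omega)) (hlt _ (by omega))
  have hpo : Odd p := by
    by_contra h
    obtain ⟨k, hk⟩ := Nat.not_odd_iff_even.1 h
    have h1 := hrec k (by omega) (by omega)
    have h2 := sum_antidiagonal_modEq_two f k
    rw [hlt k (by omega)] at h2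
    rw [show 2 * k = p by omega] at h1 h2
    unfold Int.ModEq at h2
    rcases hf p with h | h | h <;> omega
  have hp2 := Nat.odd_iff.1 hpo
  have hsupp := half_diff_eq_zero hf hrec hpo hfp hlt
  have hdvd : ∀ i, 3 ≤ i → i < n → i % 2 = 1 → f i = 0 → p ∣ n - i := by
    intro i hi hin hio h0
    by_contra h
    exact hrefl i (n - i) (by omega) (by omega) (by omega) h0
      (hsupp _ h (Or.inl ⟨Nat.even_iff.2 (by omega), by omega⟩))
  have hpair : ∀ i j, 3 ≤ i → i < j → j < n → i % 2 = 1 → j % 2 = 1 → f i = 0 → f j = 0 →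
      p ∣ j - i := by
    intro i j hi hij hj hi2 hj2 h0 h0'
    have h := Nat.dvd_sub (hdvd i hi (by omega) hi2 h0) (hdvd j (by omega) hj hj2 h0')
    rwa [show n - i - (n - j) = j - i by omega] at h
  have hsmall : ∀ i, i % 2 = 1 → i + p ≤ n - 3 → ¬ p ∣ i → f i = 0 := fun i hi hip hpi =>
    hsupp i hpi (Or.inr ⟨Nat.odd_iff.2 hi, hip⟩)
  rcases (by omega : p = 3 ∨ p = 5 ∨ 7 ≤ p) with rfl | rfl | hp7
  · have := hpair 5 7 (by omega) (by omega) (by omega) rfl rfl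
      (hsmall 5 rfl (by omega) (by omega)) (hsmall 7 rfl (by omega) (by omega))
    omega
  · have := hpair 3 7 (by omega) (by omega) (by omega) rfl rfl
      (hlt 3 (by omega)) (hsmall 7 rfl (by omega) (by omega))
    omega
  · have := Nat.le_of_dvd (by omega) <| hpair 3 5 (by omega) (by omega) (by omega) rfl rfl
      (hlt 3 (by omega)) (hlt 5 (by omega))
    omega

theorem stmt17 (n : ℕ) (hodd : Odd n) (h13 : 13 < n) :
    ¬ ∃ a : ℕ → ℤ, (∀ j ∈ Icc 1 n, a j = 1 ∨ a j = -1) ∧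
      ∀ k, 1 ≤ k → k ≤ n - 1 → |∑ j ∈ Icc 1 (n - k), a j * a (j + k)| ≤ 1 := by
  rintro ⟨a, ha, hc⟩
  have ha1 := ha 1 (by rw [mem_Icc]; omega)
  have ha2 := ha 2 (by rw [mem_Icc]; omega)
  have hsq1 : a 1 * a 1 = 1 := by rcases ha1 with h | h <;> rw [h] <;> norm_num
  have hsq2 : a 2 * a 2 = 1 := by rcases ha2 with h | h <;> rw [h] <;> norm_num
  obtain ⟨t, ht, htt⟩ : ∃ t : ℤ, (t = 1 ∨ t = -1) ∧ t = a 1 * a 2 :=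
    ⟨_, by rcases ha1 with h | h <;> rcases ha2 with h' | h' <;> rw [h, h'] <;> norm_num, rfl⟩
  have htp : ∀ i : ℕ, t ^ i = 1 ∨ t ^ i = -1 := by
    intro i
    rcases ht with rfl | rfl
    · simp
    · exact neg_one_pow_eq_or ℤ i
  let b : ℕ → ℤ := fun i => if i < n then a 1 * t ^ i * a (i + 1) else 1
  have hbi : ∀ i < n, b i = a 1 * t ^ i * a (i + 1) := fun i hi => if_pos hi
  refine no_normalized_barker (b := b) hodd h13 (fun i => ?_) ?_ ?_ ?_
  · by_cases hi : i < n
    · rw [hbi i hi]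
      have ha' := ha (i + 1) (by rw [mem_Icc]; omega)
      rcases ha1 with h | h <;> rcases htp i with h' | h' <;> rcases ha' with h'' | h'' <;>
        rw [h, h', h''] <;> norm_num
    · exact Or.inl (if_neg hi)
  · rw [hbi 0 (by omega), pow_zero, mul_one, hsq1]
  · rw [hbi 1 (by omega), pow_one, htt]
    linear_combination a 2 * a 2 * hsq1 + hsq2
  · intro N k hN hk hNk
    have h := hc k hk (by omega)
    have heq : autocorr b N k = t ^ k * ∑ j ∈ Icc 1 (n - k), a j * a (j + k) := by
      rw [show n - k = N by omega, autocorr, ← Ico_add_one_right_eq_Icc,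
        sum_Ico_eq_sum_range, Nat.add_sub_cancel, mul_sum]
      refine sum_congr rfl fun i hi => ?_
      rw [mem_range] at hi
      have h2 : t ^ i * t ^ i = 1 := by rcases htp i with h | h <;> rw [h] <;> norm_num
      rw [hbi i (by omega), hbi (i + k) (by omega), show i + k + 1 = 1 + i + k by ring,
        add_comm i 1, pow_add]
      linear_combination (t ^ i * t ^ i * t ^ k * a (1 + i) * a (1 + i + k)) * hsq1
        + t ^ k * a (1 + i) * a (1 + i + k) * h2
    rw [heq, abs_mul]
    rcases htp k with h' | h' <;> rw [h'] <;> simpa using h
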